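/- Fix integers 0 ≤ k ≤ n. There exists c = c(n) > 0 with the following property. Let μ be a finite Borel measure on B_2(0) ⊆ ℝⁿ, let δ > 0, and let B_r(x) be a ball with B_{2r}(x) ⊆ B_2(0) such that μ(B_r(x)) ≥ 4^k ε_n r^k and ∫_{B_{2r}(x)} D^k_μ(y, 2r) dμ(y) < δ² (2r)^k. Then D^k_μ(x, r) < c δ². -/

import Mathlib

open MeasureTheory Metric Set
open scoped ENNReal NNReal RealInnerProductSpace

noncomputable section

/-- Euclidean `n`-space. -/
abbrev En (n : ℕ) : Type := EuclideanSpace ℝ (Fin n)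

/-- `ε_n = (1000 n)^(-7 n²)`. -/
def epsn (n : ℕ) : ℝ := (1000 * (n : ℝ)) ^ (-(7 * (n : ℤ) ^ 2))

/-- `ω_k`: the Lebesgue volume of the unit ball in `ℝ^k`. -/
def omegak (k : ℕ) : ℝ := (volume (ball (0 : En k) 1)).toReal

/-- `γ_k = ω_k 40^{-k}`. -/
def gammak (k : ℕ) : ℝ := omegak k * (40 : ℝ)⁻¹ ^ k

/-- A `k`-dimensional affine subspace of `ℝⁿ`: nonempty, with direction of finrank `k`. -/
def IsAffineSubspaceDim (n k : ℕ) (L : AffineSubspace ℝ (En n)) : Prop :=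
  (L : Set (En n)).Nonempty ∧ Module.finrank ℝ L.direction = k

/-- The `k`-dimensional displacement `D^k_μ(x,r)` of a measure `μ`. -/
def displ (n k : ℕ) (μ : Measure (En n)) (x : En n) (r : ℝ) : ℝ :=
  if ENNReal.ofReal (epsn n * r ^ k) ≤ μ (ball x r) then
    ⨅ L : {L : AffineSubspace ℝ (En n) // IsAffineSubspaceDim n k L},
      r ^ (-(k : ℤ) - 2) * ∫ y in ball x r, (Metric.infDist y (L.1 : Set (En n))) ^ 2 ∂μ
  else 0

/-- The displacement `D^k_S` of a set `S`, i.e. of `λ^k` restricted to `S`. -/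
def displSet (n k : ℕ) (S : Set (En n)) (x : En n) (r : ℝ) : ℝ :=
  displ n k ((μH[(k : ℝ)] : Measure (En n)).restrict S) x r

/-- `k`-rectifiability: countably many Lipschitz images of `ℝ^k` cover up to `λ^k`-null. -/
def IsRectifiableDim (n k : ℕ) (T : Set (En n)) : Prop :=
  ∃ f : ℕ → (En k → En n),
    (∀ i, ∃ K : ℝ≥0, LipschitzWith K (f i)) ∧
    μH[(k : ℝ)] (T \ ⋃ i, Set.range (f i)) = 0

lemma epsn_pos (n : ℕ) : 0 < epsn n := by
  unfold epsn
  rcases Nat.eq_zero_or_pos n with h | h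
  · subst h; norm_num
  · have : (0 : ℝ) < n := by exact_mod_cast h
    positivity

lemma intOn_sq {n : ℕ} (μ : Measure (En n)) [IsFiniteMeasure μ] {f : En n → ℝ}
    (hf : Continuous f) (y : En n) (ρ : ℝ) :
    IntegrableOn (fun z => f z ^ 2) (ball y ρ) μ :=
  ((hf.pow 2).continuousOn.integrableOn_compact (isCompact_closedBall y ρ)).mono_set
    ball_subset_closedBall

lemma cont_functional {n : ℕ} (μ : Measure (En n)) [IsFiniteMeasure μ] (y : En n) (ρ : ℝ) :
    Continuous (fun f : C(En n, ℝ) => ∫ z in ball y ρ, f z ^ 2 ∂μ) := by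
  rw [continuous_iff_continuousAt]
  intro f
  have hK := isCompact_closedBall y ρ
  obtain ⟨M, hM⟩ := hK.exists_bound_of_continuousOn f.continuous.continuousOn
  have hu := (ContinuousMap.tendsto_iff_forall_isCompact_tendstoUniformlyOn.1
    (Filter.tendsto_id (α := C(En n, ℝ)) (x := nhds f))) _ hK
  rw [Metric.tendstoUniformlyOn_iff] at hu
  refine tendsto_integral_filter_of_dominated_convergence (fun _ => (M + 1) ^ 2) ?_ ?_ ?_ ?_
  · exact Filter.Eventually.of_forall fun g => (g.continuous.pow 2).aestronglyMeasurable
  · filter_upwards [hu 1 one_pos] with g hg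
    refine ae_restrict_of_forall_mem measurableSet_ball fun z hz => ?_
    have hz' := ball_subset_closedBall hz
    have h1 := hg z hz'
    have h2 := hM z hz'
    rw [Real.dist_eq] at h1
    simp only [id] at h1
    rw [Real.norm_eq_abs] at h2
    rw [norm_pow, Real.norm_eq_abs]
    have : |g z| ≤ M + 1 := by
      have := abs_sub_abs_le_abs_sub (g z) (f z)
      rw [abs_sub_comm] at this
      linarith
    exact pow_le_pow_left₀ (abs_nonneg _) this 2
  · exact integrable_const _
  · refine Filter.Eventually.of_forall fun z => ?_
    exact (((continuous_eval_const (F := C(En n, ℝ)) z).pow 2).tendsto f)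

lemma meas_ball {n : ℕ} (μ : Measure (En n)) [IsFiniteMeasure μ] (ρ : ℝ) :
    Measurable (fun y : En n => μ (ball y ρ)) := by
  have hs : MeasurableSet {p : En n × En n | dist p.2 p.1 < ρ} :=
    (isOpen_lt (by fun_prop) (by fun_prop)).measurableSet
  exact measurable_measure_prodMk_left hs

lemma meas_int {n : ℕ} (μ : Measure (En n)) [IsFiniteMeasure μ] {f : En n → ℝ}
    (hf : Continuous f) (ρ : ℝ) :
    Measurable (fun y : En n => ∫ z in ball y ρ, f z ^ 2 ∂μ) := by
  have hs : MeasurableSet {p : En n × En n | dist p.2 p.1 < ρ} :=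
    (isOpen_lt (by fun_prop) (by fun_prop)).measurableSet
  have h1 : StronglyMeasurable
      (indicator {p : En n × En n | dist p.2 p.1 < ρ} (fun p => f p.2 ^ 2)) :=
    StronglyMeasurable.indicator
      (((hf.comp continuous_snd).pow 2).stronglyMeasurable) hs
  have h2 := (h1.integral_prod_right' (ν := μ)).measurable
  convert h2 using 2 with y
  rw [← integral_indicator measurableSet_ball]
  rfl

/-- index type -/
abbrev Lk (n k : ℕ) := {L : AffineSubspace ℝ (En n) // IsAffineSubspaceDim n k L}

def dfun {n k : ℕ} (L : Lk n k) : C(En n, ℝ) :=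
  ⟨fun z => Metric.infDist z (L.1 : Set (En n)), continuous_infDist_pt _⟩

lemma bddB {n : ℕ} {ι : Type*} (μ : Measure (En n)) {ρ : ℝ} (m : ℤ) (hρ : 0 < ρ) (y : En n)
    (F : ι → En n → ℝ) :
    BddBelow (range fun L => ρ ^ m * ∫ z in ball y ρ, F L z ^ 2 ∂μ) := by
  refine ⟨0, ?_⟩
  rintro _ ⟨L, rfl⟩
  have : 0 ≤ ∫ z in ball y ρ, F L z ^ 2 ∂μ := integral_nonneg fun z => sq_nonneg _
  positivity

lemma exists_countable (n k : ℕ) [Nonempty (Lk n k)] :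
    ∃ u : ℕ → Lk n k, ∀ (μ : Measure (En n)) [IsFiniteMeasure μ] (y : En n) (ρ : ℝ) (m : ℤ),
      0 < ρ →
      (⨅ L : Lk n k, ρ ^ m * ∫ z in ball y ρ, (Metric.infDist z (L.1 : Set (En n))) ^ 2 ∂μ)
      = ⨅ i : ℕ, ρ ^ m * ∫ z in ball y ρ, (Metric.infDist z ((u i).1 : Set (En n))) ^ 2 ∂μ := by
  have : Nonempty (range (dfun (n := n) (k := k))) := inferInstance
  let v := TopologicalSpace.denseSeq (range (dfun (n := n) (k := k)))
  have hv : DenseRange v := TopologicalSpace.denseRange_denseSeq _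
  choose u hu using fun i => (v i).2
  refine ⟨u, fun μ _ y ρ m hρ => ?_⟩
  apply le_antisymm
  · refine le_ciInf fun i => ?_
    exact ciInf_le (bddB μ m hρ y (fun (L : Lk n k) z => Metric.infDist z (L.1 : Set (En n)))) (u i)
  · refine le_ciInf fun L => ?_
    refine le_of_forall_gt fun t ht => ?_
    let Φ : range (dfun (n := n) (k := k)) → ℝ := fun f => ρ ^ m * ∫ z in ball y ρ, f.1 z ^ 2 ∂μ
    have hΦ : Continuous Φ :=
      continuous_const.mul ((cont_functional μ y ρ).comp continuous_subtype_val)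
    obtain ⟨i, hi⟩ := hv.exists_mem_open (isOpen_Iio.preimage hΦ : IsOpen (Φ ⁻¹' Iio t))
      ⟨⟨dfun L, L, rfl⟩, ht⟩
    refine lt_of_le_of_lt (ciInf_le
      (bddB μ m hρ y (fun i z => Metric.infDist z ((u i).1 : Set (En n)))) i) ?_
    have : Φ (v i) < t := hi
    simp only [Φ, ← hu i] at this
    exact this

lemma displ_nonneg (n k : ℕ) (μ : Measure (En n)) (y : En n) {ρ : ℝ} (hρ : 0 < ρ) :
    0 ≤ displ n k μ y ρ := by
  unfold displ
  split_ifs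
  · refine Real.iInf_nonneg fun L => ?_
    have : 0 ≤ ∫ z in ball y ρ, (Metric.infDist z (L.1 : Set (En n))) ^ 2 ∂μ :=
      integral_nonneg fun z => sq_nonneg _
    positivity
  · exact le_rfl

lemma meas_displ (n k : ℕ) [Nonempty (Lk n k)] (μ : Measure (En n)) [IsFiniteMeasure μ]
    {ρ : ℝ} (hρ : 0 < ρ) : Measurable (fun y => displ n k μ y ρ) := by
  obtain ⟨u, hu⟩ := exists_countable n k
  unfold displ
  refine Measurable.ite (measurableSet_le measurable_const (meas_ball μ ρ)) ?_ measurable_const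
  have : (fun y : En n => ⨅ L : Lk n k, ρ ^ (-(k : ℤ) - 2) *
      ∫ z in ball y ρ, (Metric.infDist z (L.1 : Set (En n))) ^ 2 ∂μ) = _ :=
    funext fun y => hu μ y ρ (-(k : ℤ) - 2) hρ
  rw [this]
  exact Measurable.iInf fun i => (meas_int μ (continuous_infDist_pt _) ρ).const_mul _

lemma integrable_displ (n k : ℕ) [Nonempty (Lk n k)] (μ : Measure (En n)) [IsFiniteMeasure μ]
    {ρ : ℝ} (hρ : 0 < ρ) (x : En n) : IntegrableOn (fun y => displ n k μ y ρ) (ball x ρ) μ := by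
  obtain ⟨L⟩ : Nonempty (Lk n k) := inferInstance
  let f : En n → ℝ := fun z => Metric.infDist z (L.1 : Set (En n))
  have hf : Continuous f := continuous_infDist_pt _
  refine Integrable.of_bound (C := ρ ^ (-(k : ℤ) - 2) * ∫ z in ball x (2 * ρ), f z ^ 2 ∂μ)
    (meas_displ n k μ hρ).aestronglyMeasurable ?_
  refine ae_restrict_of_forall_mem measurableSet_ball fun y hy => ?_
  rw [Real.norm_of_nonneg (displ_nonneg n k μ y hρ)]
  have h0 : 0 ≤ ∫ z in ball x (2 * ρ), f z ^ 2 ∂μ := integral_nonneg fun z => sq_nonneg _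
  unfold displ
  split_ifs
  · refine (ciInf_le (bddB μ _ hρ y
      (fun (L : Lk n k) z => Metric.infDist z (L.1 : Set (En n)))) L).trans ?_
    refine mul_le_mul_of_nonneg_left ?_ (by positivity)
    refine setIntegral_mono_set (intOn_sq μ hf x (2 * ρ))
      (Filter.Eventually.of_forall fun z => sq_nonneg _) ?_
    refine Filter.Eventually.of_forall (?_ : ball y ρ ⊆ ball x (2 * ρ))
    refine ball_subset_ball' ?_
    rw [mem_ball] at hy
    linarith
  · positivity

lemma displ_compare (n k : ℕ) [Nonempty (Lk n k)] (μ : Measure (En n)) [IsFiniteMeasure μ]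
    {r : ℝ} (hr : 0 < r) (x y : En n) (hy : y ∈ ball x r)
    (hμ : ENNReal.ofReal (4 ^ k * epsn n * r ^ k) ≤ μ (ball x r)) :
    displ n k μ x r ≤ 2 ^ (k + 2) * displ n k μ y (2 * r) := by
  have he := epsn_pos n
  have hsub : ball x r ⊆ ball y (2 * r) := by
    refine ball_subset_ball' ?_
    rw [mem_ball, dist_comm] at hy
    linarith
  have c1 : ENNReal.ofReal (epsn n * r ^ k) ≤ μ (ball x r) := by
    refine le_trans (ENNReal.ofReal_le_ofReal ?_) hμ
    have : (1 : ℝ) ≤ 4 ^ k := one_le_pow₀ (by norm_num)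
    have h2 : 0 < epsn n * r ^ k := by positivity
    nlinarith
  have c2 : ENNReal.ofReal (epsn n * (2 * r) ^ k) ≤ μ (ball y (2 * r)) := by
    refine le_trans (ENNReal.ofReal_le_ofReal ?_) (hμ.trans (measure_mono hsub))
    have : (2 : ℝ) ^ k ≤ 4 ^ k := pow_le_pow_left₀ (by norm_num) (by norm_num) k
    have h2 : 0 < epsn n * r ^ k := by positivity
    rw [mul_pow]
    nlinarith
  unfold displ
  rw [if_pos c1, if_pos c2, Real.mul_iInf_of_nonneg (by positivity)]
  refine le_ciInf fun L => ?_
  refine (ciInf_le (bddB μ _ hr x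
      (fun (L : Lk n k) z => Metric.infDist z (L.1 : Set (En n)))) L).trans ?_
  have e : (2 : ℝ) ^ (k + 2) * ((2 * r) ^ (-(k : ℤ) - 2)) = r ^ (-(k : ℤ) - 2) := by
    have : (-(k : ℤ) - 2) = -((k + 2 : ℕ) : ℤ) := by push_cast; ring
    rw [this, zpow_neg, zpow_neg, zpow_natCast, zpow_natCast, mul_pow]
    field_simp
  rw [← mul_assoc, e]
  refine mul_le_mul_of_nonneg_left ?_ (by positivity)
  exact setIntegral_mono_set (intOn_sq μ (continuous_infDist_pt _) y (2 * r))
    (Filter.Eventually.of_forall fun z => sq_nonneg _)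
    (Filter.Eventually.of_forall hsub)

/-- Lemma 4.17: pointwise estimate on the displacement from an
integral bound at double scale. -/
theorem statement14 (n : ℕ) :
    ∃ c : ℝ, 0 < c ∧
      ∀ k : ℕ, k ≤ n →
      ∀ μ : Measure (En n), IsFiniteMeasure μ → μ ((ball (0 : En n) 2)ᶜ) = 0 →
      ∀ δ : ℝ, 0 < δ →
      ∀ (x : En n) (r : ℝ), 0 < r → ball x (2 * r) ⊆ ball (0 : En n) 2 →
        ENNReal.ofReal (4 ^ k * epsn n * r ^ k) ≤ μ (ball x r) →
        (∫ y in ball x (2 * r), displ n k μ y (2 * r) ∂μ) < δ ^ 2 * (2 * r) ^ k →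
        displ n k μ x r < c * δ ^ 2 := by
  have he := epsn_pos n
  refine ⟨4 / epsn n, by positivity, ?_⟩
  intro k _ μ hfin _ δ hδ x r hr _ hμ hint
  by_cases hne : Nonempty (Lk n k)
  swap
  · have hE : IsEmpty (Lk n k) := not_nonempty_iff.1 hne
    have : displ n k μ x r = 0 := by
      unfold displ
      split_ifs
      · exact Real.iInf_of_isEmpty _
      · rfl
    rw [this]
    positivity
  have h2r : 0 < 2 * r := by linarith
  have hI := integrable_displ n k μ h2r x
  have hsub : ball x r ⊆ ball x (2 * r) := ball_subset_ball (by linarith)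
  have h1 : ∫ y in ball x r, displ n k μ y (2 * r) ∂μ
      ≤ ∫ y in ball x (2 * r), displ n k μ y (2 * r) ∂μ :=
    setIntegral_mono_set hI
      (Filter.Eventually.of_forall fun z => displ_nonneg n k μ z h2r)
      (Filter.Eventually.of_forall hsub)
  have h2 : ∫ _y in ball x r, displ n k μ x r ∂μ
      ≤ ∫ y in ball x r, 2 ^ (k + 2) * displ n k μ y (2 * r) ∂μ :=
    setIntegral_mono_on integrableOn_const ((hI.mono_set hsub).const_mul _) measurableSet_ball
      fun y hy => displ_compare n k μ hr x y hy hμ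
  rw [setIntegral_const, integral_const_mul, smul_eq_mul] at h2
  have h3 : 4 ^ k * epsn n * r ^ k ≤ μ.real (ball x r) :=
    (ENNReal.ofReal_le_iff_le_toReal (measure_ne_top _ _)).1 hμ
  have hD := displ_nonneg n k μ x hr
  have h4 : 4 ^ k * epsn n * r ^ k * displ n k μ x r < 2 ^ (k + 2) * (δ ^ 2 * (2 * r) ^ k) :=
    calc _ ≤ μ.real (ball x r) * displ n k μ x r := by gcongr
      _ ≤ _ := h2
      _ < _ := by
        have := h1.trans_lt hint
        gcongr
  have h5 : (2 : ℝ) ^ (k + 2) * (δ ^ 2 * (2 * r) ^ k) = (4 ^ k * r ^ k) * (4 * δ ^ 2) := by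
    rw [show (4 : ℝ) = 2 * 2 by norm_num, mul_pow, mul_pow, pow_add]; ring
  rw [h5] at h4
  have h6 : epsn n * displ n k μ x r < 4 * δ ^ 2 := by
    have hp : (0 : ℝ) < 4 ^ k * r ^ k := by positivity
    refine lt_of_mul_lt_mul_left ?_ hp.le
    calc _ = 4 ^ k * epsn n * r ^ k * displ n k μ x r := by ring
      _ < _ := h4
  rw [div_mul_eq_mul_div, lt_div_iff₀ he]
  linarith
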